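/- arXiv:2006.04235 — 2 statements merged into one kernel-verified Lean document; each statement's English description precedes it below -/
import Mathlib

section
/- Fix t > 0. There exist constants m₁, m₂ > 0 (depending only on t) such that for every j ≥ 1 and every k ∈ {1,…,2^j}, m₁ ≤ q_{j,k,k} ≤ m₂. -/
open MeasureTheory Real Finset

/-- `F t u = ∫_0^t (1/(2√(π r))) e^{−u²/(4r)} dr`, the covariance of the mild solution of the
stochastic heat equation at time `t` between spatial points at distance `u`. -/
noncomputable def F (t u : ℝ) : ℝ :=
  ∫ r in (0:ℝ)..t, (1 / (2 * Real.sqrt (Real.pi * r))) * Real.exp (-u ^ 2 / (4 * r))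

/-- Dyadic points: `a j k 0 = (2k−1)/2^{j+1}`, `a j k 1 = 2k/2^{j+1}`, `a j k 2 = (2k−2)/2^{j+1}`. -/
noncomputable def a (j k : ℕ) (m : ℕ) : ℝ :=
  (2 * (k : ℝ) - (if m = 0 then 1 else if m = 1 then 0 else 2)) / 2 ^ (j + 1)

/-- Weights `c 0 = 1`, `c 1 = c 2 = −1/2`. -/
noncomputable def c (m : ℕ) : ℝ := if m = 0 then 1 else -(1 / 2)

/-- `q t j k k' = E[z_{jk} z_{jk'}]` for the Schauder coefficients of the solution in space. -/
noncomputable def q (t : ℝ) (j k k' : ℕ) : ℝ :=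
  4 * 2 ^ j * ∑ m ∈ Finset.range 3, ∑ m' ∈ Finset.range 3,
    c m * c m' * F t (a j k m - a j k' m')

/-- The heat kernel on the diagonal at time `r`, as a power of `r`. -/
lemma heat_diag_eq_rpow {r : ℝ} (hr : 0 ≤ r) :
    1 / (2 * √(π * r)) = (2 * √π)⁻¹ * r ^ (-1 / 2 : ℝ) := by
  rw [Real.sqrt_mul pi_pos.le, show (-1 / 2 : ℝ) = -(1 / 2) by norm_num, Real.rpow_neg hr,
    ← Real.sqrt_eq_rpow, one_div, ← mul_assoc, mul_inv]

lemma intervalIntegrable_heat_diag {b : ℝ} (hb : 0 ≤ b) :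
    IntervalIntegrable (fun r => 1 / (2 * √(π * r))) volume 0 b := by
  have h : IntervalIntegrable (fun r : ℝ => (2 * √π)⁻¹ * r ^ (-1 / 2 : ℝ)) volume 0 b :=
    (intervalIntegral.intervalIntegrable_rpow' (by norm_num)).const_mul _
  refine h.congr fun r hr => ?_
  rw [Set.uIoc_of_le hb] at hr
  exact (heat_diag_eq_rpow hr.1.le).symm

lemma integral_heat_diag {b : ℝ} (hb : 0 ≤ b) :
    ∫ r in (0 : ℝ)..b, 1 / (2 * √(π * r)) = √b / √π := by
  have h : ∫ r in (0 : ℝ)..b, 1 / (2 * √(π * r)) =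
      ∫ r in (0 : ℝ)..b, (2 * √π)⁻¹ * r ^ (-1 / 2 : ℝ) := by
    refine intervalIntegral.integral_congr fun r hr => ?_
    rw [Set.uIcc_of_le hb] at hr
    exact heat_diag_eq_rpow hr.1
  have hpi : √π ≠ 0 := (Real.sqrt_pos.2 pi_pos).ne'
  rw [h, intervalIntegral.integral_const_mul, integral_rpow (by norm_num), Real.sqrt_eq_rpow b,
    show (-1 / 2 + 1 : ℝ) = 1 / 2 by norm_num, Real.zero_rpow (by norm_num)]
  field_simp
  ring

lemma intervalIntegrable_heat_diag_mul {b C : ℝ} (hb : 0 ≤ b) {f : ℝ → ℝ} (hf : Measurable f)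
    (hC : ∀ r, 0 < r → |f r| ≤ C) :
    IntervalIntegrable (fun r => 1 / (2 * √(π * r)) * f r) volume 0 b := by
  refine ((intervalIntegrable_heat_diag hb).const_mul C).mono_fun
    (by fun_prop) ?_
  refine (ae_restrict_iff' measurableSet_uIoc).2 (Filter.Eventually.of_forall fun r hr => ?_)
  rw [Set.uIoc_of_le hb] at hr
  have h0 : 0 ≤ 1 / (2 * √(π * r)) := by positivity
  have h := hC r hr.1
  dsimp only
  rw [Real.norm_eq_abs, Real.norm_eq_abs, abs_mul, abs_mul, mul_comm |C|]
  exact mul_le_mul_of_nonneg_left (h.trans (le_abs_self C)) (abs_nonneg _)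

lemma exp_neg_sq_div_le_one (u : ℝ) {r : ℝ} (hr : 0 < r) : Real.exp (-u ^ 2 / (4 * r)) ≤ 1 := by
  rw [Real.exp_le_one_iff, neg_div, neg_nonpos]
  positivity

/-- The combination `3/2 - 2 x + x ^ 4 / 2`, factored, at `x = e^{-h²/(4r)}`. -/
noncomputable def schauderProfile (h r : ℝ) : ℝ :=
  (1 - Real.exp (-h ^ 2 / (4 * r))) ^ 2 *
    (Real.exp (-h ^ 2 / (4 * r)) ^ 2 + 2 * Real.exp (-h ^ 2 / (4 * r)) + 3) / 2

lemma schauderProfile_nonneg (h r : ℝ) : 0 ≤ schauderProfile h r := by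
  unfold schauderProfile
  positivity

lemma le_schauderProfile (h r : ℝ) :
    3 / 2 * (1 - Real.exp (-h ^ 2 / (4 * r))) ^ 2 ≤ schauderProfile h r := by
  unfold schauderProfile
  have hx := Real.exp_pos (-h ^ 2 / (4 * r))
  have : 0 ≤ (1 - Real.exp (-h ^ 2 / (4 * r))) ^ 2 *
    (Real.exp (-h ^ 2 / (4 * r)) ^ 2 + 2 * Real.exp (-h ^ 2 / (4 * r))) := by positivity
  linarith

lemma schauderProfile_le (h : ℝ) {r : ℝ} (hr : 0 < r) :
    schauderProfile h r ≤ 3 * (1 - Real.exp (-h ^ 2 / (4 * r))) := by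
  unfold schauderProfile
  have hx := Real.exp_pos (-h ^ 2 / (4 * r))
  have hx1 := exp_neg_sq_div_le_one h hr
  generalize Real.exp (-h ^ 2 / (4 * r)) = x at *
  have h1 : x ^ 2 + 2 * x + 3 ≤ 6 := by nlinarith
  have h2 : (1 - x) ^ 2 ≤ 1 - x := by nlinarith
  nlinarith [mul_le_mul h2 h1 (by positivity) (by linarith)]

lemma schauderProfile_le_three (h : ℝ) {r : ℝ} (hr : 0 < r) : schauderProfile h r ≤ 3 := by
  linarith [schauderProfile_le h hr, Real.exp_pos (-h ^ 2 / (4 * r))]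

lemma schauderProfile_le_div (h : ℝ) {r : ℝ} (hr : 0 < r) :
    schauderProfile h r ≤ 3 * (h ^ 2 / (4 * r)) := by
  have := Real.add_one_le_exp (-h ^ 2 / (4 * r))
  rw [neg_div] at this
  have h2 := schauderProfile_le h hr
  rw [neg_div] at h2
  linarith

lemma measurable_schauderProfile (h : ℝ) : Measurable (schauderProfile h) := by
  unfold schauderProfile
  fun_prop

lemma intervalIntegrable_schauderProfile (h : ℝ) {b : ℝ} (hb : 0 ≤ b) :
    IntervalIntegrable (fun r => 1 / (2 * √(π * r)) * schauderProfile h r) volume 0 b :=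
  intervalIntegrable_heat_diag_mul hb (measurable_schauderProfile h) fun r hr => by
    rw [abs_of_nonneg (schauderProfile_nonneg h r)]
    exact schauderProfile_le_three h hr

lemma F_neg (t u : ℝ) : F t (-u) = F t u := by
  simp [F]

lemma F_secondDiff_eq {t : ℝ} (ht : 0 ≤ t) (h : ℝ) :
    3 / 2 * F t 0 - 2 * F t h + 1 / 2 * F t (2 * h) =
      ∫ r in (0 : ℝ)..t, 1 / (2 * √(π * r)) * schauderProfile h r := by
  have hi (u : ℝ) : IntervalIntegrable
      (fun r => 1 / (2 * √(π * r)) * Real.exp (-u ^ 2 / (4 * r))) volume 0 t :=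
    intervalIntegrable_heat_diag_mul ht (by fun_prop) fun r hr => by
      rw [abs_of_pos (Real.exp_pos _)]
      exact exp_neg_sq_div_le_one u hr
  unfold F
  rw [← intervalIntegral.integral_const_mul, ← intervalIntegral.integral_const_mul,
    ← intervalIntegral.integral_const_mul,
    ← intervalIntegral.integral_sub ((hi 0).const_mul _) ((hi h).const_mul _),
    ← intervalIntegral.integral_add (((hi 0).const_mul _).sub ((hi h).const_mul _))
      ((hi (2 * h)).const_mul _)]
  congr 1
  ext r
  have e4 : Real.exp (-(2 * h) ^ 2 / (4 * r)) = Real.exp (-h ^ 2 / (4 * r)) ^ 4 := by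
    rw [← Real.exp_nat_mul]
    congr 1
    push_cast
    ring
  rw [e4, schauderProfile]
  simp only [ne_eq, OfNat.ofNat_ne_zero, not_false_eq_true, zero_pow, neg_zero, zero_div,
    Real.exp_zero]
  ring

lemma q_diag_eq (t : ℝ) (j k : ℕ) :
    q t j k k = 2 * 2 ^ (j + 1) * (3 / 2 * F t 0 - 2 * F t (1 / 2 ^ (j + 1)) +
      1 / 2 * F t (2 * (1 / 2 ^ (j + 1)))) := by
  have h01 : a j k 0 - a j k 1 = -(1 / 2 ^ (j + 1)) := by simp [a]; ring
  have h02 : a j k 0 - a j k 2 = 1 / 2 ^ (j + 1) := by simp [a]; ring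
  have h12 : a j k 1 - a j k 2 = 2 * (1 / 2 ^ (j + 1)) := by simp [a]; ring
  have h10 : a j k 1 - a j k 0 = 1 / 2 ^ (j + 1) := by linarith
  have h20 : a j k 2 - a j k 0 = -(1 / 2 ^ (j + 1)) := by linarith
  have h21 : a j k 2 - a j k 1 = -(2 * (1 / 2 ^ (j + 1))) := by linarith
  simp only [q, Finset.sum_range_succ, Finset.sum_range_zero, h01, h02, h12, h10, h20, h21,
    sub_self, F_neg]
  simp only [c, if_true, one_ne_zero, if_false, OfNat.ofNat_ne_zero]
  ring

lemma le_integral_schauderProfile {t h : ℝ} (ht : 0 < t) (hh : 0 < h) (hh1 : h ≤ 1) :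
    3 / 2 * (1 - Real.exp (-(1 / (4 * t)))) ^ 2 * (h * √t / √π) ≤
      ∫ r in (0 : ℝ)..t, 1 / (2 * √(π * r)) * schauderProfile h r := by
  have hs0 : 0 < t * h ^ 2 := by positivity
  have hst : t * h ^ 2 ≤ t := mul_le_of_le_one_right ht.le (pow_le_one₀ hh.le hh1)
  have hsqrt : √(t * h ^ 2) = h * √t := by
    rw [Real.sqrt_mul ht.le, Real.sqrt_sq hh.le, mul_comm]
  calc
    _ = ∫ r in (0 : ℝ)..t * h ^ 2,
          3 / 2 * (1 - Real.exp (-(1 / (4 * t)))) ^ 2 * (1 / (2 * √(π * r))) := by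
      rw [intervalIntegral.integral_const_mul, integral_heat_diag hs0.le, hsqrt]
    _ ≤ ∫ r in (0 : ℝ)..t * h ^ 2, 1 / (2 * √(π * r)) * schauderProfile h r := by
      refine intervalIntegral.integral_mono_on_of_le_Ioo hs0.le
        ((intervalIntegrable_heat_diag hs0.le).const_mul _)
        (intervalIntegrable_schauderProfile h hs0.le) fun r hr => ?_
      rw [mul_comm]
      refine mul_le_mul_of_nonneg_left (le_trans ?_ (le_schauderProfile h r)) (by positivity)
      have hle : Real.exp (-h ^ 2 / (4 * r)) ≤ Real.exp (-(1 / (4 * t))) := by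
        rw [Real.exp_le_exp, neg_div, neg_le_neg_iff,
          div_le_div_iff₀ (by positivity) (by linarith [hr.1])]
        nlinarith [hr.2]
      have hlt : Real.exp (-(1 / (4 * t))) ≤ 1 := by
        rw [Real.exp_le_one_iff, neg_nonpos]
        positivity
      gcongr
    _ ≤ _ := by
      refine intervalIntegral.integral_mono_interval le_rfl hs0.le hst
        (Filter.Eventually.of_forall fun r => ?_) (intervalIntegrable_schauderProfile h ht.le)
      exact mul_nonneg (by positivity) (schauderProfile_nonneg h r)

lemma integral_schauderProfile_tail_le {h T : ℝ} (hh : 0 < h) (hT : h ^ 2 ≤ T) :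
    ∫ r in h ^ 2..T, 1 / (2 * √(π * r)) * schauderProfile h r ≤ h / √π := by
  have hh2 : 0 < h ^ 2 := by positivity
  have hT0 : 0 < T := hh2.trans_le hT
  have hmem : (0 : ℝ) ∉ Set.uIcc (h ^ 2) T := by
    rw [Set.uIcc_of_le hT]
    exact fun hz => hh2.not_ge hz.1
  have hpow : (h ^ 2) ^ (-1 / 2 : ℝ) = h⁻¹ := by
    rw [← Real.rpow_natCast, ← Real.rpow_mul hh.le]
    norm_num [Real.rpow_neg_one]
  calc
    _ ≤ ∫ r in h ^ 2..T, 3 * h ^ 2 / (8 * √π) * r ^ (-3 / 2 : ℝ) := by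
      refine intervalIntegral.integral_mono_on hT
        ((intervalIntegrable_schauderProfile h hT0.le).mono_set ?_)
        ((intervalIntegral.intervalIntegrable_rpow (Or.inr hmem)).const_mul _) fun r hr => ?_
      · rw [Set.uIcc_of_le hT, Set.uIcc_of_le hT0.le]
        exact Set.Icc_subset_Icc_left hh2.le
      have hr0 : 0 < r := hh2.trans_le hr.1
      calc
        _ ≤ 1 / (2 * √(π * r)) * (3 * (h ^ 2 / (4 * r))) :=
          mul_le_mul_of_nonneg_left (schauderProfile_le_div h hr0) (by positivity)
        _ = _ := by
          rw [heat_diag_eq_rpow hr0.le, show (-3 / 2 : ℝ) = -1 / 2 - 1 by norm_num,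
            Real.rpow_sub_one hr0.ne']
          field_simp
          ring
    _ = 3 * h ^ 2 / (8 * √π) * (2 * (h⁻¹ - T ^ (-1 / 2 : ℝ))) := by
      rw [intervalIntegral.integral_const_mul, integral_rpow (Or.inr ⟨by norm_num, hmem⟩),
        show (-3 / 2 + 1 : ℝ) = -1 / 2 by norm_num, hpow]
      ring
    _ ≤ 3 * h ^ 2 / (8 * √π) * (2 * h⁻¹) := by
      have := Real.rpow_nonneg hT0.le (-1 / 2 : ℝ)
      gcongr
      linarith
    _ = 3 / 4 * (h / √π) := by
      field_simp
      ring
    _ ≤ h / √π := by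
      have : 0 ≤ h / √π := by positivity
      linarith

lemma integral_schauderProfile_le {t h : ℝ} (ht : 0 < t) (hh : 0 < h) :
    ∫ r in (0 : ℝ)..t, 1 / (2 * √(π * r)) * schauderProfile h r ≤ 4 * (h / √π) := by
  have hh2 : 0 < h ^ 2 := by positivity
  have hT : 0 ≤ t + h ^ 2 := by positivity
  have hsub : Set.uIcc (h ^ 2) (t + h ^ 2) ⊆ Set.uIcc 0 (t + h ^ 2) := by
    rw [Set.uIcc_of_le (by linarith), Set.uIcc_of_le hT]
    exact Set.Icc_subset_Icc_left hh2.le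
  have hhead : ∫ r in (0 : ℝ)..h ^ 2, 1 / (2 * √(π * r)) * schauderProfile h r ≤
      3 * (h / √π) := by
    calc
      _ ≤ ∫ r in (0 : ℝ)..h ^ 2, 3 * (1 / (2 * √(π * r))) := by
        refine intervalIntegral.integral_mono_on_of_le_Ioo hh2.le
          (intervalIntegrable_schauderProfile h hh2.le)
          ((intervalIntegrable_heat_diag hh2.le).const_mul _) fun r hr => ?_
        rw [mul_comm 3]
        exact mul_le_mul_of_nonneg_left (schauderProfile_le_three h hr.1) (by positivity)
      _ = _ := by
        rw [intervalIntegral.integral_const_mul, integral_heat_diag hh2.le, Real.sqrt_sq hh.le]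
  calc
    _ ≤ ∫ r in (0 : ℝ)..t + h ^ 2, 1 / (2 * √(π * r)) * schauderProfile h r :=
      intervalIntegral.integral_mono_interval le_rfl ht.le (by linarith)
        (Filter.Eventually.of_forall fun r =>
          mul_nonneg (by positivity) (schauderProfile_nonneg h r))
        (intervalIntegrable_schauderProfile h hT)
    _ = _ := (intervalIntegral.integral_add_adjacent_intervals
        (intervalIntegrable_schauderProfile h hh2.le)
        ((intervalIntegrable_schauderProfile h hT).mono_set hsub)).symm
    _ ≤ 3 * (h / √π) + h / √π :=
      add_le_add hhead (integral_schauderProfile_tail_le hh (by linarith))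
    _ = _ := by ring

theorem stmt_10 (t : ℝ) (ht : 0 < t) :
    ∃ m₁ m₂ : ℝ, 0 < m₁ ∧ 0 < m₂ ∧ ∀ j : ℕ, 1 ≤ j → ∀ k ∈ Finset.Icc 1 (2 ^ j),
      m₁ ≤ q t j k k ∧ q t j k k ≤ m₂ := by
  have hlt : Real.exp (-(1 / (4 * t))) < 1 := by
    rw [Real.exp_lt_one_iff, neg_lt_zero]
    positivity
  have hpos : 0 < 1 - Real.exp (-(1 / (4 * t))) := sub_pos.2 hlt
  refine ⟨3 * (1 - Real.exp (-(1 / (4 * t)))) ^ 2 * (√t / √π), 8 / √π, by positivity,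
    by positivity, fun j _ k _ => ?_⟩
  have hN : (0 : ℝ) < 2 ^ (j + 1) := by positivity
  have hh : (0 : ℝ) < 1 / 2 ^ (j + 1) := by positivity
  have hh1 : (1 : ℝ) / 2 ^ (j + 1) ≤ 1 :=
    (div_le_one hN).2 (one_le_pow₀ one_le_two)
  rw [q_diag_eq, F_secondDiff_eq ht.le]
  constructor
  · refine le_trans (le_of_eq ?_)
      (mul_le_mul_of_nonneg_left (le_integral_schauderProfile ht hh hh1) (by positivity))
    field_simp
  · refine (mul_le_mul_of_nonneg_left (integral_schauderProfile_le ht hh)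
      (by positivity)).trans (le_of_eq ?_)
    field_simp
    norm_num
end

section
/- Fix t > 0 and a compact interval [a,b] ⊂ ℝ with a < b. There exists a constant c_t > 0 (depending on t, a, b) such that for all x, y ∈ [a,b], c_t |x−y| ≤ ∫_0^t ∫_ℝ (G(r, x−z) − G(r, y−z))² dz dr ≤ |x−y|. -/
open MeasureTheory Real

/-- The Green kernel (heat kernel) of the heat equation `∂ₜu = (1/2)Δu` on `ℝ`. -/
noncomputable def G (t x : ℝ) : ℝ :=
  if 0 < t then (1 / Real.sqrt (2 * Real.pi * t)) * Real.exp (-x ^ 2 / (2 * t)) else 0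

lemma G_mul_G {r : ℝ} (hr : 0 < r) (x y z : ℝ) :
    G r (x - z) * G r (y - z) = (1 / (2 * π * r) * exp (-(x - y) ^ 2 / (4 * r))) *
      exp (-(1 / r) * (z - (x + y) / 2) ^ 2) := by
  have h : √(2 * π * r) * √(2 * π * r) = 2 * π * r := mul_self_sqrt (by positivity)
  rw [G, G, if_pos hr, if_pos hr, mul_mul_mul_comm, ← exp_add, mul_assoc (1 / (2 * π * r)),
    ← exp_add, div_mul_div_comm, h, one_mul]
  congr 2
  field_simp
  ring

lemma integrable_G_mul_G {r : ℝ} (hr : 0 < r) (x y : ℝ) :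
    Integrable fun z => G r (x - z) * G r (y - z) := by
  simp_rw [G_mul_G hr]
  exact ((integrable_exp_neg_mul_sq (one_div_pos.2 hr)).comp_sub_right _).const_mul _

lemma integral_G_mul_G {r : ℝ} (hr : 0 < r) (x y : ℝ) :
    ∫ z, G r (x - z) * G r (y - z) = 1 / (2 * √(π * r)) * exp (-(x - y) ^ 2 / (4 * r)) := by
  simp_rw [G_mul_G hr]
  rw [integral_const_mul, integral_sub_right_eq_self (fun z => exp (-(1 / r) * z ^ 2)),
    integral_gaussian, div_div_eq_mul_div, div_one]
  have h : √(π * r) * √(π * r) = π * r := mul_self_sqrt (by positivity)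
  have h0 : 0 < √(π * r) := by positivity
  rw [mul_right_comm]
  congr 1
  rw [mul_assoc 2 π r]
  field_simp
  rw [sq, h]

lemma integral_sq_G_sub_G {r : ℝ} (hr : 0 < r) (x y : ℝ) :
    ∫ z, (G r (x - z) - G r (y - z)) ^ 2 =
      1 / √(π * r) * (1 - exp (-|x - y| ^ 2 / (4 * r))) := by
  have h : ∀ z, (G r (x - z) - G r (y - z)) ^ 2 = G r (x - z) * G r (x - z) +
      G r (y - z) * G r (y - z) - 2 * (G r (x - z) * G r (y - z)) := fun z => by ring
  simp_rw [h]
  rw [integral_sub (by exact (integrable_G_mul_G hr x x).add (integrable_G_mul_G hr y y))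
      ((integrable_G_mul_G hr x y).const_mul 2),
    integral_add (integrable_G_mul_G hr x x) (integrable_G_mul_G hr y y), integral_const_mul,
    integral_G_mul_G hr, integral_G_mul_G hr, integral_G_mul_G hr, sq_abs]
  have h0 : 0 < √(π * r) := by positivity
  simp only [sub_self]
  norm_num
  field_simp
  ring

/-- The squared `L²` distance between two heat kernels at time `r` whose centres are at
distance `d`. -/
noncomputable def kernelDist (d r : ℝ) : ℝ := 1 / √(π * r) * (1 - exp (-d ^ 2 / (4 * r)))

lemma kernelDist_nonneg (d : ℝ) {r : ℝ} (hr : 0 ≤ r) : 0 ≤ kernelDist d r := by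
  refine mul_nonneg (by positivity) (sub_nonneg.2 (exp_le_one_iff.2 ?_))
  exact div_nonpos_of_nonpos_of_nonneg (by nlinarith [sq_nonneg d]) (by positivity)

lemma intervalIntegrable_kernelDist (d : ℝ) {s t : ℝ} (hs : 0 ≤ s) (ht : 0 ≤ t) :
    IntervalIntegrable (kernelDist d) volume s t := by
  have h : IntervalIntegrable (fun r : ℝ => r ^ (-(1 / 2) : ℝ)) volume s t :=
    intervalIntegral.intervalIntegrable_rpow' (by norm_num)
  refine (h.const_mul (1 / √π)).mono_fun ?_ ?_
  · apply Measurable.aestronglyMeasurable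
    unfold kernelDist
    fun_prop
  · refine (ae_restrict_iff' measurableSet_uIoc).2 (.of_forall fun r hr => ?_)
    have hr : 0 < r := lt_of_le_of_lt (le_min hs ht) hr.1
    beta_reduce
    rw [norm_of_nonneg (kernelDist_nonneg d hr.le), norm_of_nonneg (by positivity),
      rpow_neg hr.le, ← sqrt_eq_rpow, kernelDist, sqrt_mul pi_pos.le, one_div_mul_eq_div,
      one_div_mul_eq_div, ← one_div, div_div, mul_comm √r]
    gcongr
    linarith [exp_pos (-d ^ 2 / (4 * r))]

/-- The unnormalised error function. -/
noncomputable def gaussPrimitive (u : ℝ) : ℝ := ∫ v in (0 : ℝ)..u, exp (-v ^ 2)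

lemma hasDerivAt_gaussPrimitive (u : ℝ) : HasDerivAt gaussPrimitive (exp (-u ^ 2)) u :=
  (show Continuous fun v : ℝ => exp (-v ^ 2) by fun_prop).integral_hasStrictDerivAt 0 u
    |>.hasDerivAt

lemma gaussPrimitive_le {u : ℝ} (hu : 0 ≤ u) : gaussPrimitive u ≤ √π / 2 := by
  have h := integral_gaussian_Ioi 1
  have hi := integrable_exp_neg_mul_sq one_pos
  simp only [neg_mul, one_mul, div_one] at h hi
  rw [← h, gaussPrimitive, intervalIntegral.integral_of_le hu]
  exact setIntegral_mono_set hi.integrableOn (.of_forall fun _ => (exp_pos _).le)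
    (Set.Ioc_subset_Ioi_self.eventuallyLE)

lemma one_sub_exp_le_gaussPrimitive {u : ℝ} (hu : 0 ≤ u) :
    1 - exp (-u ^ 2) ≤ 2 * u * gaussPrimitive u := by
  have h : ∫ v in (0 : ℝ)..u, 2 * v * exp (-v ^ 2) = 1 - exp (-u ^ 2) := by
    rw [intervalIntegral.integral_eq_sub_of_hasDerivAt (f := fun v => -exp (-v ^ 2))]
    · simp; ring
    · intro v _
      refine ((hasDerivAt_pow 2 v).neg.exp).neg.congr_deriv ?_
      simp only [Pi.neg_apply]
      push_cast
      ring
    · exact Continuous.intervalIntegrable (by fun_prop) _ _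
  rw [← h, gaussPrimitive, ← intervalIntegral.integral_const_mul]
  refine intervalIntegral.integral_mono_on hu (Continuous.intervalIntegrable (by fun_prop) _ _)
    (Continuous.intervalIntegrable (by fun_prop) _ _) fun v hv => ?_
  have := hv.2
  gcongr

/-- A primitive of `kernelDist d` on `(0, ∞)`. -/
noncomputable def kernelDistPrimitive (d r : ℝ) : ℝ :=
  2 / √π * (√r * (1 - exp (-(d / (2 * √r)) ^ 2)) - d * gaussPrimitive (d / (2 * √r)))

lemma hasDerivAt_kernelDistPrimitive (d : ℝ) {r : ℝ} (hr : 0 < r) :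
    HasDerivAt (kernelDistPrimitive d) (kernelDist d r) r := by
  have hs : 0 < √r := sqrt_pos.2 hr
  have h1 := hasDerivAt_sqrt hr.ne'
  have hu : HasDerivAt (fun r : ℝ => d / (2 * √r)) (-(d / (4 * √r ^ 3))) r := by
    refine ((hasDerivAt_const r d).div (h1.const_mul 2) (by positivity)).congr_deriv ?_
    field_simp
    ring
  have hE := (hasDerivAt_gaussPrimitive (d / (2 * √r))).comp r hu
  have hexp := ((hu.pow 2).neg.exp).const_sub 1
  refine (((h1.mul hexp).sub (hE.const_mul d)).const_mul (2 / √π)).congr_deriv ?_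
  have harg : -d ^ 2 / (4 * r) = -(d / (2 * √r)) ^ 2 := by
    rw [div_pow, mul_pow, sq_sqrt hr.le]; ring
  have hpi : 0 < √π := sqrt_pos.2 pi_pos
  rw [kernelDist, harg, sqrt_mul pi_pos.le]
  simp only [Pi.pow_apply, Pi.neg_apply, Nat.add_one_sub_one, pow_one, Nat.cast_ofNat]
  generalize exp (-(d / (2 * √r)) ^ 2) = e
  field_simp
  ring

lemma kernelDistPrimitive_nonpos {d r : ℝ} (hd : 0 ≤ d) (hr : 0 < r) :
    kernelDistPrimitive d r ≤ 0 := by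
  have hs : 0 < √r := sqrt_pos.2 hr
  refine mul_nonpos_of_nonneg_of_nonpos (by positivity) (sub_nonpos.2 ?_)
  calc √r * (1 - exp (-(d / (2 * √r)) ^ 2))
      ≤ √r * (2 * (d / (2 * √r)) * gaussPrimitive (d / (2 * √r))) := by
        gcongr; exact one_sub_exp_le_gaussPrimitive (by positivity)
    _ = d * gaussPrimitive (d / (2 * √r)) := by field_simp

lemma neg_le_kernelDistPrimitive {d r : ℝ} (hd : 0 ≤ d) : -d ≤ kernelDistPrimitive d r := by
  have hpi : 0 < √π := sqrt_pos.2 pi_pos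
  have h1 : 0 ≤ √r * (1 - exp (-(d / (2 * √r)) ^ 2)) :=
    mul_nonneg (sqrt_nonneg r) (sub_nonneg.2 (exp_le_one_iff.2 (neg_nonpos.2 (sq_nonneg _))))
  have h2 : d * gaussPrimitive (d / (2 * √r)) ≤ d * (√π / 2) := by
    gcongr; exact gaussPrimitive_le (by positivity)
  calc -d = 2 / √π * (0 - d * (√π / 2)) := by field_simp; ring
    _ ≤ kernelDistPrimitive d r := by unfold kernelDistPrimitive; gcongr

lemma integral_kernelDist_le {d t : ℝ} (hd : 0 ≤ d) (ht : 0 < t) :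
    ∫ r in (0 : ℝ)..t, kernelDist d r ≤ d := by
  have hcont : ContinuousOn (fun s => ∫ r in t..s, kernelDist d r) (Set.uIcc 0 t) :=
    intervalIntegral.continuousOn_primitive_interval'
      (intervalIntegrable_kernelDist d le_rfl ht.le) Set.right_mem_uIcc
  have hlim : Filter.Tendsto (fun s => -∫ r in t..s, kernelDist d r) (nhdsWithin 0 (Set.Ioc 0 t))
      (nhds (-∫ r in t..0, kernelDist d r)) := by
    refine ((hcont 0 Set.left_mem_uIcc).mono ?_).neg
    rw [Set.uIcc_of_le ht.le]
    exact Set.Ioc_subset_Icc_self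
  have : (nhdsWithin (0 : ℝ) (Set.Ioc 0 t)).NeBot := by
    rw [nhdsWithin_Ioc_eq_nhdsGT ht]; infer_instance
  rw [intervalIntegral.integral_symm]
  refine le_of_tendsto hlim ?_
  filter_upwards [self_mem_nhdsWithin] with s hs
  rw [← intervalIntegral.integral_symm,
    intervalIntegral.integral_eq_sub_of_hasDerivAt (f := kernelDistPrimitive d)
      (fun r hr => hasDerivAt_kernelDistPrimitive d
        (hs.1.trans_le (Set.uIcc_of_le hs.2 ▸ hr).1))
      (intervalIntegrable_kernelDist d hs.1.le ht.le)]
  linarith [kernelDistPrimitive_nonpos hd ht, neg_le_kernelDistPrimitive (r := s) hd]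

lemma le_integral_kernelDist {d t κ : ℝ} (hd : 0 ≤ d) (hκ : 0 < κ) (h : κ * d ^ 2 ≤ t) :
    √κ / √π * (1 - exp (-(1 / (4 * κ)))) * d ≤ ∫ r in (0 : ℝ)..t, kernelDist d r := by
  have hs : 0 ≤ κ * d ^ 2 := by positivity
  have ht : 0 ≤ t := hs.trans h
  rcases hd.eq_or_lt with rfl | hd
  · rw [mul_zero]
    exact intervalIntegral.integral_nonneg ht fun r hr => kernelDist_nonneg 0 hr.1
  have hexp : 0 ≤ 1 - exp (-(1 / (4 * κ))) :=
    sub_nonneg.2 (exp_le_one_iff.2 (neg_nonpos.2 (by positivity)))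
  calc √κ / √π * (1 - exp (-(1 / (4 * κ)))) * d
      = ∫ _ in (0 : ℝ)..κ * d ^ 2, 1 / √(π * (κ * d ^ 2)) * (1 - exp (-(1 / (4 * κ)))) := by
        have hk : 0 < √κ := sqrt_pos.2 hκ
        have hpi : 0 < √π := sqrt_pos.2 pi_pos
        rw [intervalIntegral.integral_const, smul_eq_mul, sub_zero, sqrt_mul pi_pos.le,
          sqrt_mul hκ.le, sqrt_sq hd.le]
        nth_rw 3 [← sq_sqrt hκ.le]
        field_simp
    _ ≤ ∫ r in (0 : ℝ)..κ * d ^ 2, kernelDist d r := by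
        refine intervalIntegral.integral_mono_on_of_le_Ioo hs (by simp)
          (intervalIntegrable_kernelDist d le_rfl hs) fun r hr => ?_
        have hr0 := hr.1
        have hr1 := hr.2.le
        have harg : -d ^ 2 / (4 * r) ≤ -(1 / (4 * κ)) := by
          rw [neg_div, neg_le_neg_iff, div_le_div_iff₀ (by positivity) (by positivity)]
          linarith
        unfold kernelDist
        gcongr
    _ ≤ ∫ r in (0 : ℝ)..t, kernelDist d r := by
        refine intervalIntegral.integral_mono_interval le_rfl hs h ?_
          (intervalIntegrable_kernelDist d le_rfl ht)
        exact (ae_restrict_iff' measurableSet_Ioc).2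
          (.of_forall fun r hr => kernelDist_nonneg d hr.1.le)

theorem stmt_16 (t : ℝ) (ht : 0 < t) (a b : ℝ) (hab : a < b) :
    ∃ ct : ℝ, 0 < ct ∧ ∀ x ∈ Set.Icc a b, ∀ y ∈ Set.Icc a b,
      ct * |x - y| ≤ (∫ r in (0:ℝ)..t, ∫ z : ℝ, (G r (x - z) - G r (y - z)) ^ 2) ∧
      (∫ r in (0:ℝ)..t, ∫ z : ℝ, (G r (x - z) - G r (y - z)) ^ 2) ≤ |x - y| := by
  have hL : 0 < b - a := sub_pos.2 hab
  have hκ : 0 < t / (b - a) ^ 2 := by positivity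
  refine ⟨√(t / (b - a) ^ 2) / √π * (1 - exp (-(1 / (4 * (t / (b - a) ^ 2))))),
    mul_pos (by positivity) (sub_pos.2 (Real.exp_lt_one_iff.2 (neg_neg_of_pos (by positivity)))),
    fun x hx y hy => ?_⟩
  have heq : (∫ r in (0:ℝ)..t, ∫ z : ℝ, (G r (x - z) - G r (y - z)) ^ 2) =
      ∫ r in (0 : ℝ)..t, kernelDist |x - y| r := by
    refine intervalIntegral.integral_congr_ae (.of_forall fun r hr => ?_)
    rw [Set.uIoc_of_le ht.le] at hr
    exact integral_sq_G_sub_G hr.1 x y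
  rw [heq]
  refine ⟨le_integral_kernelDist (abs_nonneg _) hκ ?_, integral_kernelDist_le (abs_nonneg _) ht⟩
  have hxy : |x - y| ≤ b - a := abs_sub_le_of_le_of_le hx.1 hx.2 hy.1 hy.2
  calc t / (b - a) ^ 2 * |x - y| ^ 2 ≤ t / (b - a) ^ 2 * (b - a) ^ 2 := by gcongr
    _ = t := by field_simp
end
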